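/- arXiv:1702.01734 — 3 statements merged into one kernel-verified Lean document; each statement's English description precedes it below -/
import Mathlib

section
/- Let {P_1,…,P_m} be polynomials with root-sets N_i ⊆ N and degrees 0 ≤ d_i ≤ m−1, and let R ⊆ N be an acceptable reduction set, with indices chosen so that the reduced degrees satisfy d̃_i < m−1 for all i ∈ [m−1] and d̃_m = m−1. If W(P_1,…,P_m) ≡ 0, then W(P̃_1,…,P̃_{m−1}) ≡ 0, where W(P̃_1,…,P̃_{m−1}) is the determinant of the (m−1)×(m−1) matrix of coefficients of P̃_1,…,P̃_{m−1} (each of degree at most m−2). -/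
open Polynomial

/-- The polynomial `P(α) = ∏_{γ ∈ Ni} (α - γ)`, where the roots are the
indeterminates `α_j` for `j ∈ Ni`, viewed as a univariate polynomial over the
multivariate polynomial ring `F[α_1, …, α_n]`. -/
noncomputable def rootPoly (F : Type*) [Field F] {n : ℕ} (Ni : Finset (Fin n)) :
    Polynomial (MvPolynomial (Fin n) F) :=
  ∏ γ ∈ Ni, (Polynomial.X - Polynomial.C (MvPolynomial.X γ))

/-- For `m` polynomials of degree at most `m - 1` given by their root-sets,
`W(Q_1, …, Q_m) = det((C_{j,i})_{i,j ∈ [m]})`, where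
`Q_i(α) = Σ_{j=1}^m C_{i,j} α^{j-1}`. -/
noncomputable def Wdet (F : Type*) [Field F] {n m : ℕ}
    (N : Fin m → Finset (Fin n)) : MvPolynomial (Fin n) F :=
  Matrix.det (Matrix.of fun i j : Fin m => (rootPoly F (N j)).coeff (i : ℕ))

/-- `HasTopCoeff p r q` says that the coefficients of `p`, as polynomials in the inner variable,
have degree at most `r`, and that their coefficients of degree `r` form the polynomial `q`. -/
def HasTopCoeff {A : Type*} [CommRing A] (p : A[X][X]) (r : ℕ) (q : A[X]) : Prop :=
  ∀ k, (p.coeff k).natDegree ≤ r ∧ (p.coeff k).coeff r = q.coeff k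

theorem HasTopCoeff.one {A : Type*} [CommRing A] : HasTopCoeff (1 : A[X][X]) 0 1 := by
  intro k
  rw [coeff_one, coeff_one]
  split_ifs <;> simp

theorem HasTopCoeff.mul {A : Type*} [CommRing A] {p p' : A[X][X]} {r r' : ℕ} {q q' : A[X]}
    (h : HasTopCoeff p r q) (h' : HasTopCoeff p' r' q') :
    HasTopCoeff (p * p') (r + r') (q * q') := by
  intro k
  rw [coeff_mul, coeff_mul]
  refine ⟨natDegree_sum_le_of_forall_le _ _ fun x _ ↦
    natDegree_mul_le_of_le (h x.1).1 (h' x.2).1, ?_⟩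
  rw [finsetSum_coeff]
  refine Finset.sum_congr rfl fun x _ ↦ ?_
  rw [coeff_mul_add_eq_of_natDegree_le (h x.1).1 (h' x.2).1, (h x.1).2, (h' x.2).2]

theorem HasTopCoeff.prod {A ι : Type*} [CommRing A] (s : Finset ι) {p : ι → A[X][X]} {r : ι → ℕ}
    {q : ι → A[X]} (h : ∀ i ∈ s, HasTopCoeff (p i) (r i) (q i)) :
    HasTopCoeff (∏ i ∈ s, p i) (∑ i ∈ s, r i) (∏ i ∈ s, q i) := by
  classical
  induction s using Finset.induction_on with
  | empty => simpa using HasTopCoeff.one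
  | insert a s ha ih =>
    rw [Finset.prod_insert ha, Finset.sum_insert ha, Finset.prod_insert ha]
    exact (h a (by simp)).mul (ih fun i hi ↦ h i (by simp [hi]))

theorem HasTopCoeff.X_sub_C_C {A : Type*} [CommRing A] (a : A) :
    HasTopCoeff (X - C (C a) : A[X][X]) 0 (X - C a) := by
  intro k
  simp only [coeff_sub, coeff_X, coeff_C]
  split_ifs <;> simp

theorem HasTopCoeff.X_sub_C_C_mul_X {A : Type*} [CommRing A] (a : A) :
    HasTopCoeff (X - C (C a * X) : A[X][X]) 1 (C (-a)) := by
  intro k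
  rw [coeff_sub, coeff_X, coeff_C, coeff_C]
  rcases k with _ | k
  · simpa using natDegree_C_mul_le a X |>.trans natDegree_X_le
  · rw [if_neg k.succ_ne_zero, if_neg k.succ_ne_zero, sub_zero]
    split_ifs <;> simp [coeff_one]

theorem natDegree_prod_le_and_coeff_prod {A ι : Type*} [CommRing A] (s : Finset ι) (p : ι → A[X])
    (r : ι → ℕ) (h : ∀ i ∈ s, (p i).natDegree ≤ r i) :
    (∏ i ∈ s, p i).natDegree ≤ ∑ i ∈ s, r i ∧
      (∏ i ∈ s, p i).coeff (∑ i ∈ s, r i) = ∏ i ∈ s, (p i).coeff (r i) := by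
  classical
  induction s using Finset.induction_on with
  | empty => simp
  | insert a s ha ih =>
    have h1 := h a (by simp)
    have h2 := ih fun i hi ↦ h i (by simp [hi])
    rw [Finset.prod_insert ha, Finset.sum_insert ha, Finset.prod_insert ha]
    exact ⟨natDegree_mul_le_of_le h1 h2.1, by
      rw [coeff_mul_add_eq_of_natDegree_le h1 h2.1, h2.2]⟩

/-- If the entries of the `j`-th column have degree at most `r j`, the coefficient of degree
`∑ j, r j` of the determinant is the determinant of the top coefficients. -/
theorem coeff_det_of_natDegree_le {A ι : Type*} [CommRing A] [Fintype ι] [DecidableEq ι]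
    (M : Matrix ι ι A[X]) (r : ι → ℕ) (h : ∀ i j, (M i j).natDegree ≤ r j) :
    M.det.coeff (∑ j, r j) = (Matrix.of fun i j ↦ (M i j).coeff (r j)).det := by
  rw [Matrix.det_apply, Matrix.det_apply, finsetSum_coeff]
  refine Finset.sum_congr rfl fun σ _ ↦ ?_
  have := (natDegree_prod_le_and_coeff_prod Finset.univ (fun j ↦ M (σ j) j) r
    fun j _ ↦ h _ _).2
  rw [Units.smul_def, Units.smul_def, coeff_smul, this]
  rfl

/-- Multiplies the indeterminates indexed by `R` by a new variable. -/
noncomputable def scaleVars (F : Type*) [Field F] {n : ℕ} (R : Finset (Fin n)) :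
    MvPolynomial (Fin n) F →+* (MvPolynomial (Fin n) F)[X] :=
  MvPolynomial.eval₂Hom (C.comp MvPolynomial.C) fun γ ↦
    if γ ∈ R then C (MvPolynomial.X γ) * X else C (MvPolynomial.X γ)

theorem scaleVars_X (F : Type*) [Field F] {n : ℕ} (R : Finset (Fin n)) (γ : Fin n) :
    scaleVars F R (MvPolynomial.X γ) =
      if γ ∈ R then C (MvPolynomial.X γ) * X else C (MvPolynomial.X γ) :=
  MvPolynomial.eval₂Hom_X' _ _ _

theorem hasTopCoeff_map_rootPoly (F : Type*) [Field F] {n : ℕ} (R S : Finset (Fin n)) :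
    HasTopCoeff ((rootPoly F S).map (scaleVars F R)) (∑ γ ∈ S, if γ ∈ R then 1 else 0)
      (C (∏ γ ∈ S with γ ∈ R, -MvPolynomial.X γ) * rootPoly F (S \ R)) := by
  have key : C (∏ γ ∈ S with γ ∈ R, -MvPolynomial.X γ) * rootPoly F (S \ R) =
      ∏ γ ∈ S, if γ ∈ R then C (-MvPolynomial.X γ) else X - C (MvPolynomial.X γ) := by
    rw [Finset.prod_ite, map_prod, rootPoly, Finset.sdiff_eq_filter]
  rw [key, rootPoly, Polynomial.map_prod]
  refine HasTopCoeff.prod S fun γ _ ↦ ?_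
  rw [Polynomial.map_sub, map_X, map_C, scaleVars_X]
  split_ifs
  · exact HasTopCoeff.X_sub_C_C_mul_X (MvPolynomial.X γ)
  · exact HasTopCoeff.X_sub_C_C (MvPolynomial.X γ)

theorem Wdet_sdiff_eq_zero (F : Type*) [Field F] {n m : ℕ} (N : Fin m → Finset (Fin n))
    (R : Finset (Fin n)) (hW : Wdet F N = 0) : Wdet F (fun i ↦ N i \ R) = 0 := by
  have h0 := congrArg (scaleVars F R) hW
  rw [Wdet, map_zero, RingHom.map_det] at h0
  have h1 := coeff_det_of_natDegree_le
    (((scaleVars F R).mapMatrix (Matrix.of fun i j : Fin m ↦ (rootPoly F (N j)).coeff (i : ℕ))))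
    (fun j ↦ ∑ γ ∈ N j, if γ ∈ R then 1 else 0) fun i j ↦ by
      simpa using (hasTopCoeff_map_rootPoly F R (N j) i).1
  rw [h0, coeff_zero] at h1
  have h2 := Matrix.det_mul_row (fun j ↦ ∏ γ ∈ N j with γ ∈ R, -MvPolynomial.X γ)
    (Matrix.of fun i j : Fin m ↦ (rootPoly F (N j \ R)).coeff (i : ℕ))
  have h3 : (Matrix.of fun i j : Fin m ↦ (∏ γ ∈ N j with γ ∈ R, -MvPolynomial.X γ) *
      (Matrix.of fun i j : Fin m ↦ (rootPoly F (N j \ R)).coeff (i : ℕ)) i j).det = 0 := by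
    rw [h1]
    congr 1
    ext1 i j
    have := (hasTopCoeff_map_rootPoly F R (N j) i).2
    rw [coeff_C_mul, coeff_map] at this
    exact this.symm
  rw [h3] at h2
  refine (mul_eq_zero.mp h2.symm).resolve_left ?_
  simp [Finset.prod_ne_zero_iff]

theorem rootPoly_monic (F : Type*) [Field F] {n : ℕ} (S : Finset (Fin n)) :
    (rootPoly F S).Monic :=
  monic_prod_X_sub_C _ _

theorem natDegree_rootPoly (F : Type*) [Field F] {n : ℕ} (S : Finset (Fin n)) :
    (rootPoly F S).natDegree = S.card :=
  natDegree_finsetProd_X_sub_C_eq_card _ _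

theorem Wdet_succ_eq (F : Type*) [Field F] {n m : ℕ} (N : Fin (m + 1) → Finset (Fin n))
    (hlast : (N (Fin.last m)).card = m) (hrest : ∀ i : Fin m, (N i.castSucc).card < m) :
    Wdet F N = Wdet F fun i : Fin m ↦ N i.castSucc := by
  have hl : (rootPoly F (N (Fin.last m))).coeff m = 1 := by
    have := (rootPoly_monic F (N (Fin.last m))).coeff_natDegree
    rwa [natDegree_rootPoly, hlast] at this
  have hr (i : Fin m) : (rootPoly F (N i.castSucc)).coeff m = 0 :=
    coeff_eq_zero_of_natDegree_lt (by rw [natDegree_rootPoly]; exact hrest i)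
  rw [Wdet, Matrix.det_succ_row _ (Fin.last m), Fin.sum_univ_castSucc]
  simp [hl, hr, Wdet, Matrix.submatrix]

/-- Lemma 1. Here the family has `m + 1` polynomials (the paper'"'"'s `m` is `m + 1`),
indexed so that the last one keeps degree `m` after reduction by the acceptable
reduction set `R` (i.e. `P̃_{m} = m - 1` in the paper'"'"'s notation), while all other
reduced degrees are `< m`.  If `W(P_1, …, P_m) ≡ 0` then
`W(P̃_1, …, P̃_{m-1}) ≡ 0`, the latter being the determinant of the
`(m-1) × (m-1)` coefficient matrix of the reduced polynomials. -/
theorem Wdet_reduced_eq_zero (F : Type*) [Field F] {n m : ℕ}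
    (N : Fin (m + 1) → Finset (Fin n))
    (hdeg : ∀ i, (N i).card ≤ m)
    (R : Finset (Fin n))
    (hacc_last : ((N (Fin.last m)) \ R).card = m)
    (hacc_rest : ∀ i : Fin m, ((N (Fin.castSucc i)) \ R).card < m)
    (hW : Wdet F N = 0) :
    Wdet F (fun i : Fin m => (N (Fin.castSucc i)) \ R) = 0 := by
  rw [← Wdet_succ_eq F (fun i ↦ N i \ R) hacc_last hacc_rest]
  exact Wdet_sdiff_eq_zero F N R hW
end

section
/- Let {P_1,…,P_m} be polynomials with root-sets N_i ⊆ N, where either m ∈ {2,3,4} and 0 ≤ d_i ≤ m−1 for all i ∈ [m] with d_m = m−1, or m = 5 and d_i = 4 for all i ∈ [5]. Suppose {P_1,…,P_m} has the generalized non-rectangular property (GNRP). Then in any run of the reduction process, with R the set of removed roots and {P_i}_⋆ = {P_1,…,P_{m−1}} under the final indexing, every strongly reducible (r,s)-subset S in {P_i}_⋆ with r + s = m satisfies S ∩ R ≠ ∅ (i.e., the reduction process breaks S). -/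
/-- Generalized rectangular property for a family of `m` polynomials given by
their root-sets `N_i` (the degree of `P_i` is `|N_i|`): for some `1 < k ≤ m`
and `0 ≤ l ≤ m - k`, there exist at least `k` polynomials of degree at most
`m - l - 1` having at least `m - k - l + 1` common roots. -/
def GRP {n m : ℕ} (N : Fin m → Finset (Fin n)) : Prop :=
  ∃ k l : ℕ, 1 < k ∧ k ≤ m ∧ l ≤ m - k ∧
    ∃ I : Finset (Fin m), k ≤ I.card ∧
      (∀ i ∈ I, (N i).card ≤ m - l - 1) ∧
      ∃ S : Finset (Fin n), m - k - l + 1 ≤ S.card ∧ ∀ i ∈ I, S ⊆ N i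

/-- `S` is an `(r, s)`-subset in the subfamily of the polynomials indexed by
`Q`: `S` is contained in the root-sets of `r` polynomials of the subfamily,
and `|S| = s`. -/
def IsRSsubset {n m : ℕ} (N : Fin m → Finset (Fin n)) (Q : Finset (Fin m))
    (r s : ℕ) (S : Finset (Fin n)) : Prop :=
  (∃ I : Finset (Fin m), I ⊆ Q ∧ I.card = r ∧ ∀ i ∈ I, S ⊆ N i) ∧ S.card = s

/-- An element `β` is removable (w.r.t. the family of `m + 1` polynomials, the
paper's `m` being `m + 1`) if `β` is a root of some but not all polynomials of
degree `m` (the paper's `m - 1`). -/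
def RemovableElt {n m : ℕ} (N : Fin (m + 1) → Finset (Fin n)) (β : Fin n) : Prop :=
  (∃ i, (N i).card = m ∧ β ∈ N i) ∧ (∃ i, (N i).card = m ∧ β ∉ N i)

/-- `S` is weakly reducible if `S` is contained in the root-set of a polynomial
of degree `m` (the paper's `m - 1`) and `S` has a removable element. -/
def WeaklyReducible {n m : ℕ} (N : Fin (m + 1) → Finset (Fin n))
    (S : Finset (Fin n)) : Prop :=
  (∃ i, (N i).card = m ∧ S ⊆ N i) ∧ ∃ β ∈ S, RemovableElt N β

/-- An `(r, s)`-subset has higher order than an `(r', s')`-subset if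
`r + s > r' + s'`, or `r + s = r' + s'` and `r > r'`. -/
def HigherOrder (r s r' s' : ℕ) : Prop :=
  r' + s' < r + s ∨ (r + s = r' + s' ∧ r' < r)

/-- A weakly reducible `(r, s)`-subset `S` (in the subfamily indexed by `Q`)
is strongly reducible if no other weakly reducible `(r', s')`-subset has
higher order than `S`. -/
def StronglyReducible {n m : ℕ} (N : Fin (m + 1) → Finset (Fin n))
    (Q : Finset (Fin (m + 1))) (r s : ℕ) (S : Finset (Fin n)) : Prop :=
  IsRSsubset N Q r s S ∧ WeaklyReducible N S ∧
    ∀ (r' s' : ℕ) (S' : Finset (Fin n)), IsRSsubset N Q r' s' S' →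
      WeaklyReducible N S' → ¬ HigherOrder r' s' r s

/-- The number of polynomials of degree `m` (the paper's `m - 1`) whose
root-set contains `β`. -/
def degCount {n m : ℕ} (N : Fin (m + 1) → Finset (Fin n)) (β : Fin n) : ℕ :=
  (Finset.univ.filter (fun i => (N i).card = m ∧ β ∈ N i)).card

/-- The number of polynomials of degree `m` (the paper's `m - 1`) in the
current family. -/
def numTop {n m : ℕ} (N : Fin (m + 1) → Finset (Fin n)) : ℕ :=
  (Finset.univ.filter (fun i => (N i).card = m)).card

/-- One round of the reduction process removes `β`, where `β` is a removable
element of some strongly reducible subset `S` of the current family, chosen so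
that no other removable element of `S` belongs to more polynomials of degree
`m` (the paper's `m - 1`) than `β`. -/
def ValidStep {n m : ℕ} (N : Fin (m + 1) → Finset (Fin n)) (β : Fin n) : Prop :=
  ∃ (S : Finset (Fin n)) (r s : ℕ),
    StronglyReducible N Finset.univ r s S ∧ β ∈ S ∧ RemovableElt N β ∧
    ∀ β' ∈ S, RemovableElt N β' → degCount N β' ≤ degCount N β

/-- A run of the reduction process: the list records the removed roots in
order; each removal is a valid step performed while more than one polynomial
of degree `m` (the paper's `m - 1`) remains, and the process stops as soon as
at most one such polynomial remains. -/
def IsRun {n m : ℕ} : (Fin (m + 1) → Finset (Fin n)) → List (Fin n) → Prop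
  | N, [] => numTop N ≤ 1
  | N, β :: L => 1 < numTop N ∧ ValidStep N β ∧ IsRun (fun i => (N i).erase β) L

/-- A step in the middle of a run is valid for the family reduced by the preceding removals. -/
theorem IsRun.validStep {n m : ℕ} {N : Fin (m + 1) → Finset (Fin n)} {A B : List (Fin n)}
    {c : Fin n} (h : IsRun N (A ++ c :: B)) : ValidStep (fun i => N i \ A.toFinset) c := by
  induction A generalizing N with
  | nil => simpa using h.2.1
  | cons b A ih =>
    have h' := ih h.2.2
    have e : (fun i => N i \ (b :: A).toFinset) = fun i => (N i).erase b \ A.toFinset := by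
      funext i
      ext x
      simp only [List.toFinset_cons, Finset.mem_sdiff, Finset.mem_insert, Finset.mem_erase]
      tauto
    rw [e]
    exact h'

/-- A list meeting `T` has a first element in `T`. -/
theorem exists_first_mem_of_list {α : Type*} [DecidableEq α] (T : Finset α) {L : List α}
    (h : ∃ x ∈ L, x ∈ T) :
    ∃ (A : List α) (c : α) (B : List α), L = A ++ c :: B ∧ c ∈ T ∧ Disjoint T A.toFinset := by
  induction L with
  | nil => simp at h
  | cons b L ih =>
    by_cases hb : b ∈ T
    · exact ⟨[], b, L, by simp, hb, by simp⟩
    · obtain ⟨A, c, B, rfl, hc, hd⟩ := ih (by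
        obtain ⟨x, hx, hxT⟩ := h
        rcases List.mem_cons.1 hx with rfl | hx
        · exact absurd hxT hb
        · exact ⟨x, hx, hxT⟩)
      refine ⟨b :: A, c, B, by simp, hc, ?_⟩
      rw [List.toFinset_cons, Finset.disjoint_insert_right]
      exact ⟨hb, hd⟩

/-- Of two positions in a list, either they agree or the earlier entry belongs to the
prefix before the later one. -/
theorem List.eq_or_mem_of_append_cons_eq {α : Type*} {A A' B B' : List α} {c c' : α}
    (h : A ++ c :: B = A' ++ c' :: B') : c = c' ∨ c ∈ A' ∨ c' ∈ A := by
  rcases List.append_eq_append_iff.1 h with ⟨C, rfl, h2⟩ | ⟨C, rfl, h2⟩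
  · cases C with
    | nil => simp at h2; simp [h2.1]
    | cons x C => simp at h2; simp [h2.1]
  · cases C with
    | nil => simp at h2; simp [h2.1]
    | cons x C => simp at h2; simp [h2.1]

/-- Under GNRP, `k ≥ 1` polynomials have at most `M - k` common roots, where `M = m + 1`. -/
theorem card_add_card_le_of_not_GRP {n m : ℕ} {N : Fin (m + 1) → Finset (Fin n)}
    (hN : ¬ GRP N) (hd : ∀ i, (N i).card ≤ m) {I : Finset (Fin (m + 1))} (hI : I.Nonempty)
    {T : Finset (Fin n)} (hT : ∀ i ∈ I, T ⊆ N i) : I.card + T.card ≤ m + 1 := by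
  by_contra hlt
  have hIm : I.card ≤ m + 1 := by simpa using Finset.card_le_univ I
  have hpos := hI.card_pos
  rcases Nat.lt_or_ge 1 I.card with h1 | h1
  · exact hN ⟨I.card, 0, h1, hIm, by omega, I, le_rfl, fun i _ => by simpa using hd i,
      T, by omega, hT⟩
  · obtain ⟨i, hi⟩ := hI
    have := Finset.card_le_card (hT i hi)
    have := hd i
    omega

theorem last_notMem_of_subset_image {m : ℕ} {I : Finset (Fin (m + 1))}
    (h : I ⊆ Finset.univ.image Fin.castSucc) : Fin.last m ∉ I := by
  intro hl
  obtain ⟨i, -, hi⟩ := Finset.mem_image.1 (h hl)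
  exact absurd hi (Fin.castSucc_lt_last i).ne

theorem subset_image_of_last_notMem {m : ℕ} {I : Finset (Fin (m + 1))}
    (h : Fin.last m ∉ I) : I ⊆ Finset.univ.image Fin.castSucc := by
  intro i hi
  obtain ⟨j, rfl⟩ := Fin.exists_castSucc_eq.2 (fun e : i = Fin.last m => h (e ▸ hi))
  exact Finset.mem_image_of_mem _ (Finset.mem_univ _)

/-- Some element of a common root-set of maximal order is not a root of the last polynomial. -/
theorem exists_mem_notMem_last {n m : ℕ} {N : Fin (m + 1) → Finset (Fin n)}
    (hN : ¬ GRP N) (hd : ∀ i, (N i).card ≤ m) {I : Finset (Fin (m + 1))}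
    (hI : Fin.last m ∉ I) {T : Finset (Fin n)} (hT : ∀ i ∈ I, T ⊆ N i)
    (hc : m + 1 ≤ I.card + T.card) : ∃ x ∈ T, x ∉ N (Fin.last m) := by
  by_contra! h
  have := card_add_card_le_of_not_GRP hN hd (Finset.insert_nonempty (Fin.last m) I)
    (T := T) (fun i hi => by
      rcases Finset.mem_insert.1 hi with rfl | hi
      · exact h
      · exact hT i hi)
  rw [Finset.card_insert_of_notMem hI] at this
  omega

/-- Bookkeeping for weak reducibility when the last polynomial has top degree. -/
theorem weaklyReducible_of_notMem_last {n m : ℕ} {N : Fin (m + 1) → Finset (Fin n)}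
    (hl : (N (Fin.last m)).card = m) {j : Fin (m + 1)} (hj : (N j).card = m)
    {T : Finset (Fin n)} (hT : T ⊆ N j) {x : Fin n} (hx : x ∈ T) (hxl : x ∉ N (Fin.last m)) :
    WeaklyReducible N T :=
  ⟨⟨j, hj, hT⟩, x, hx, ⟨j, hj, hT hx⟩, Fin.last m, hl, hxl⟩

/-- A valid step hitting a top-degree polynomial above an unbroken strongly reducible subset
comes from another subset of the same order among the first polynomials. -/
theorem exists_subset_of_validStep {n m : ℕ} {N : Fin (m + 1) → Finset (Fin n)}
    (hN : ¬ GRP N) (hd : ∀ i, (N i).card ≤ m) (hl : (N (Fin.last m)).card = m)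
    {r s : ℕ} {S : Finset (Fin n)} {I : Finset (Fin (m + 1))}
    (hI : Fin.last m ∉ I) (hIr : I.card = r) (hSI : ∀ i ∈ I, S ⊆ N i) (hSs : S.card = s)
    (hmax : ∀ (r' s' : ℕ) (S' : Finset (Fin n)),
      IsRSsubset N (Finset.univ.image Fin.castSucc) r' s' S' →
      WeaklyReducible N S' → ¬ HigherOrder r' s' r s)
    (hrs : r + s = m + 1) {j : Fin (m + 1)} (hjI : j ∈ I) (hj : (N j).card = m)
    {A : Finset (Fin n)} {c : Fin n} (hstep : ValidStep (fun i => N i \ A) c)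
    (hjA : Disjoint (N j) A) (hSA : Disjoint S A)
    (hlA : Disjoint (N (Fin.last m)) A) (hcl : c ∉ N (Fin.last m)) :
    ∃ (I' : Finset (Fin (m + 1))) (S' : Finset (Fin n)), Fin.last m ∉ I' ∧ I'.card = r ∧
      S'.card = s ∧ c ∈ S' ∧ Disjoint S' A ∧ ∀ i ∈ I', S' ⊆ N i := by
  obtain ⟨S', r', s', ⟨⟨⟨I', -, hI'r, hS'I⟩, hS's⟩, hw, hmax'⟩, hcS', -, -⟩ := hstep
  obtain ⟨x, hxS, hxl⟩ := exists_mem_notMem_last hN hd hI hSI (by omega)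
  have hSA' : ∀ i ∈ I, S ⊆ N i \ A := fun i hi =>
    Finset.subset_sdiff.2 ⟨hSI i hi, hSA⟩
  have hge := hmax' r s S ⟨⟨I, Finset.subset_univ _, hIr, hSA'⟩, hSs⟩
    (weaklyReducible_of_notMem_last (j := j) (x := x)
      (by simpa [Finset.sdiff_eq_self_of_disjoint hlA] using hl)
      (by simpa [Finset.sdiff_eq_self_of_disjoint hjA] using hj) (hSA' j hjI) hxS
      (by simp [hxl]))
  obtain ⟨⟨t, ht, hS't⟩, -⟩ := hw
  have hS't2 := Finset.subset_sdiff.1 hS't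
  have htop : (N t).card = m :=
    le_antisymm (hd t) (ht.symm.le.trans (Finset.card_le_card Finset.sdiff_subset))
  have hS'N : ∀ i ∈ I', S' ⊆ N i := fun i hi => (Finset.subset_sdiff.1 (hS'I i hi)).1
  have hlI' : Fin.last m ∉ I' := fun h => hcl (hS'N _ h hcS')
  have hle : I'.card + S'.card ≤ m + 1 := by
    rcases I'.eq_empty_or_nonempty with rfl | hne
    · have := Finset.card_le_card hS't2.1
      simp
      omega
    · exact card_add_card_le_of_not_GRP hN hd hne hS'N
  have hle' := hmax r' s' S' ⟨⟨I', subset_image_of_last_notMem hlI', hI'r, hS'N⟩, hS's⟩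
    (weaklyReducible_of_notMem_last hl htop hS't2.1 hcS' hcl)
  unfold HigherOrder at hge hle'
  exact ⟨I', S', hlI', by omega, by omega, hcS', hS't2.2, hS'N⟩

/-- Two different strongly reducible subsets of maximal order have disjoint index sets. -/
theorem disjoint_index_of_ne {n m : ℕ} {N : Fin (m + 1) → Finset (Fin n)}
    (hN : ¬ GRP N) (hd : ∀ i, (N i).card ≤ m) (hl : (N (Fin.last m)).card = m)
    {r s : ℕ} {S S' : Finset (Fin n)} {I I' : Finset (Fin (m + 1))}
    (hI : Fin.last m ∉ I) (hIr : I.card = r) (hSI : ∀ i ∈ I, S ⊆ N i) (hSs : S.card = s)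
    (hmax : ∀ (r' s' : ℕ) (S' : Finset (Fin n)),
      IsRSsubset N (Finset.univ.image Fin.castSucc) r' s' S' →
      WeaklyReducible N S' → ¬ HigherOrder r' s' r s)
    (hrs : r + s = m + 1) {j : Fin (m + 1)} (hjI : j ∈ I) (hj : (N j).card = m)
    (hI' : Fin.last m ∉ I') (hI'r : I'.card = r) (hSI' : ∀ i ∈ I', S' ⊆ N i)
    (hSs' : S'.card = s) {c : Fin n} (hcS' : c ∈ S') (hcS : c ∉ S) :
    Disjoint I I' := by
  by_contra hdis
  have hne : (I ∩ I').Nonempty := Finset.not_disjoint_iff_nonempty_inter.1 hdis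
  have h1 := card_add_card_le_of_not_GRP hN hd hne (T := S ∪ S') (fun i hi =>
    Finset.union_subset (hSI i (Finset.mem_inter.1 hi).1) (hSI' i (Finset.mem_inter.1 hi).2))
  have h2 := Finset.card_union_add_card_inter I I'
  have h3 := Finset.card_union_add_card_inter S S'
  have hlU : Fin.last m ∉ I ∪ I' := by simp [hI, hI']
  have hT : ∀ i ∈ I ∪ I', S ∩ S' ⊆ N i := fun i hi => by
    rcases Finset.mem_union.1 hi with hi | hi
    · exact Finset.inter_subset_left.trans (hSI i hi)
    · exact Finset.inter_subset_right.trans (hSI' i hi)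
  have h4 := card_add_card_le_of_not_GRP hN hd ⟨j, Finset.mem_union_left _ hjI⟩ hT
  obtain ⟨x, hx, hxl⟩ := exists_mem_notMem_last hN hd hlU hT (by omega)
  have h5 := hmax _ _ _ ⟨⟨I ∪ I', subset_image_of_last_notMem hlU, rfl, hT⟩, rfl⟩
    (weaklyReducible_of_notMem_last hl hj (hT j (Finset.mem_union_left _ hjI)) hx hxl)
  have h6 : S.card < (S ∪ S').card := Finset.card_lt_card
    ⟨Finset.subset_union_left, fun h => hcS (h (Finset.mem_union_right _ hcS'))⟩
  unfold HigherOrder at h5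
  omega

/-- Lemma 6.  The family has `m + 1` polynomials (the paper's `m` is `m + 1`).
Either the paper's `m ∈ {2, 3, 4}` with `d_i ≤ m` for all `i` and
`d_{last} = m`, or the paper's `m = 5` with all degrees equal to `4`.
Suppose the family has GNRP.  Consider any run of the reduction process with
set of removed roots `R = L.toFinset`, with indices chosen so that the reduced
degrees are nondecreasing among the first `m` polynomials, all `< m`, and the
last polynomial is untouched (`P̃_m = P_m`, of degree `m`).  Then the process
breaks every strongly reducible `(r, s)`-subset `S` of `{P_i}_⋆`
(the first `m` polynomials) with `r + s = m + 1` (the paper's `r + s = m`),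
i.e. `S ∩ R ≠ ∅`. -/
theorem reduction_breaks_strongly_reducible {n m : ℕ}
    (N : Fin (m + 1) → Finset (Fin n))
    (hcase :
      ((m + 1 = 2 ∨ m + 1 = 3 ∨ m + 1 = 4) ∧ (∀ i, (N i).card ≤ m) ∧
        (N (Fin.last m)).card = m)
      ∨ (m + 1 = 5 ∧ ∀ i, (N i).card = 4))
    (hGNRP : ¬ GRP N)
    (L : List (Fin n)) (hrun : IsRun N L)
    (hord : ∀ i j : Fin m, i ≤ j →
      ((N (Fin.castSucc i)) \ L.toFinset).card ≤ ((N (Fin.castSucc j)) \ L.toFinset).card)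
    (hstar : ∀ i : Fin m, ((N (Fin.castSucc i)) \ L.toFinset).card < m)
    (hfix : (N (Fin.last m)) ∩ L.toFinset = ∅) :
    ∀ (r s : ℕ) (S : Finset (Fin n)),
      StronglyReducible N (Finset.univ.image Fin.castSucc) r s S → r + s = m + 1 →
      (S ∩ L.toFinset).Nonempty := by
  have hd : ∀ i, (N i).card ≤ m := by
    rcases hcase with ⟨-, h, -⟩ | ⟨h5, h⟩
    · exact h
    · intro i
      rw [h i]
      omega
  have hl : (N (Fin.last m)).card = m := by
    rcases hcase with ⟨-, -, h⟩ | ⟨h5, h⟩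
    · exact h
    · rw [h]
      omega
  rintro r s S ⟨⟨⟨I, hIQ, hIr, hSI⟩, hSs⟩, ⟨⟨t, ht, hSt⟩, β, hβS, -⟩, hmax⟩ hrs
  by_contra hSR
  have hSR : Disjoint S L.toFinset :=
    Finset.disjoint_iff_inter_eq_empty.2 (Finset.not_nonempty_iff_eq_empty.1 hSR)
  have hlL : Disjoint (N (Fin.last m)) L.toFinset := Finset.disjoint_iff_inter_eq_empty.2 hfix
  have hI := last_notMem_of_subset_image hIQ
  have htI : t ∈ I := by
    by_contra htI
    have := card_add_card_le_of_not_GRP hGNRP hd (Finset.insert_nonempty t I) (T := S)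
      (fun i hi => by
        rcases Finset.mem_insert.1 hi with rfl | hi
        · exact hSt
        · exact hSI i hi)
    rw [Finset.card_insert_of_notMem htI] at this
    omega
  have key : ∀ j ∈ I, (N j).card = m → ∃ (A : List (Fin n)) (c : Fin n) (B : List (Fin n))
      (I' : Finset (Fin (m + 1))) (S' : Finset (Fin n)), L = A ++ c :: B ∧ c ∈ N j ∧ c ∉ S ∧
      Disjoint I I' ∧ Fin.last m ∉ I' ∧ I'.card = r ∧ S'.card = s ∧ c ∈ S' ∧
      Disjoint S' A.toFinset ∧ ∀ i ∈ I', S' ⊆ N i := by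
    intro j hjI hj
    have hex : ∃ x ∈ L, x ∈ N j := by
      by_contra! h
      obtain ⟨j', -, rfl⟩ := Finset.mem_image.1 (hIQ hjI)
      have h1 := hstar j'
      rw [Finset.sdiff_eq_self_of_disjoint
        (Finset.disjoint_right.2 fun x hx => h x (List.mem_toFinset.1 hx))] at h1
      omega
    obtain ⟨A, c, B, hL, hc, hA⟩ := exists_first_mem_of_list (N j) hex
    have hAL : A.toFinset ⊆ L.toFinset := fun x hx => by
      simp only [hL, List.mem_toFinset] at hx ⊢
      simp [hx]
    have hcL : c ∈ L.toFinset := by simp [hL]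
    have hcS : c ∉ S := Finset.disjoint_right.1 hSR hcL
    obtain ⟨I', S', hI', hI'r, hS's, hcS', hS'A, hSI'⟩ :=
      exists_subset_of_validStep hGNRP hd hl hI hIr hSI hSs hmax hrs hjI hj
        (IsRun.validStep (hL ▸ hrun)) hA (hSR.mono_right hAL) (hlL.mono_right hAL)
        (Finset.disjoint_right.1 hlL hcL)
    exact ⟨A, c, B, I', S', hL, hc, hcS, disjoint_index_of_ne hGNRP hd hl hI hIr hSI hSs hmax
      hrs hjI hj hI' hI'r hSI' hS's hcS' hcS, hI', hI'r, hS's, hcS', hS'A, hSI'⟩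
  have hcompl : ∀ I' : Finset (Fin (m + 1)), Disjoint I I' → Fin.last m ∉ I' →
      I.card + I'.card ≤ m ∧ (I.card + I'.card = m → I' = (insert (Fin.last m) I)ᶜ) := by
    intro I' hII' hI'
    have hsub : I' ⊆ (insert (Fin.last m) I)ᶜ := fun i hi => by
      have h1 : i ∉ I := Finset.disjoint_right.1 hII' hi
      have h2 : i ≠ Fin.last m := fun e => hI' (e ▸ hi)
      simp [h1, h2]
    have h1 := Finset.card_le_card hsub
    have h2 := Finset.card_add_card_compl (insert (Fin.last m) I)
    rw [Finset.card_insert_of_notMem hI, Fintype.card_fin] at h2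
    exact ⟨by omega, fun h => Finset.eq_of_subset_of_card_le hsub (by omega)⟩
  have hcommon : ∀ c, c ∉ S → ¬ ∀ j ∈ I, c ∈ N j := by
    intro c hcS h
    have := card_add_card_le_of_not_GRP hGNRP hd ⟨t, htI⟩ (T := insert c S)
      (fun i hi => Finset.insert_subset (h i hi) (hSI i hi))
    rw [Finset.card_insert_of_notMem hcS] at this
    omega
  obtain ⟨A, c, B, I₁, S₁, hL, hct, hcS, hd₁, hI₁, hI₁r, hS₁s, hcS₁, hS₁A, hSI₁⟩ := key t htI ht
  have hr1 : r ≠ 1 := by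
    rintro rfl
    obtain ⟨a, rfl⟩ := Finset.card_eq_one.1 hIr
    rw [Finset.mem_singleton] at htI
    subst htI
    exact hcommon c hcS (by simpa using hct)
  have hcI := hcompl I₁ hd₁ hI₁
  have hr0 : 0 < r := hIr ▸ Finset.card_pos.2 ⟨t, htI⟩
  obtain ⟨h5, h4⟩ : m + 1 = 5 ∧ ∀ i, (N i).card = 4 := by
    rcases hcase with ⟨h, -, -⟩ | h
    · omega
    · exact h
  have hr2 : r = 2 := by omega
  obtain ⟨j, hjI, hcj⟩ : ∃ j ∈ I, c ∉ N j := by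
    simpa using hcommon c hcS
  obtain ⟨A', c', B', I₂, S₂, hL', hct', hcS', hd₂, hI₂, hI₂r, hS₂s, hcS₂, hS₂A, hSI₂⟩ :=
    key j hjI (by rw [h4]; omega)
  have hI₁₂ : I₁ = I₂ := by
    rw [hcI.2 (by omega), (hcompl I₂ hd₂ hI₂).2 (by omega)]
  subst hI₁₂
  have hle := card_add_card_le_of_not_GRP hGNRP hd (Finset.card_pos.1 (by omega : 0 < I₁.card))
    (T := S₁ ∪ S₂) (fun i hi => Finset.union_subset (hSI₁ i hi) (hSI₂ i hi))
  have hS₁ : S₁ = S₁ ∪ S₂ := Finset.eq_of_subset_of_card_le Finset.subset_union_left (by omega)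
  have hS₂ : S₂ = S₁ ∪ S₂ := Finset.eq_of_subset_of_card_le Finset.subset_union_right (by omega)
  have hS₁₂ : S₁ = S₂ := hS₁.trans hS₂.symm
  rcases List.eq_or_mem_of_append_cons_eq (hL.symm.trans hL') with h | h | h
  · exact hcj (h ▸ hct')
  · exact Finset.disjoint_left.1 hS₂A (hS₁₂ ▸ hcS₁) (List.mem_toFinset.2 h)
  · exact Finset.disjoint_left.1 hS₁A (hS₁₂ ▸ hcS₂) (List.mem_toFinset.2 h)
end

section
/- Let 2 ≤ m ≤ 5 and let P_1,…,P_m be polynomials with root-sets N_i ⊆ N, each of degree exactly m−1. If {P_1,…,P_m} has the non-rectangular property (NRP), then W(P_1,…,P_m) is not the zero polynomial (i.e., the transformation matrix T with entries T_{i,j} = C_{j,i} is not generically singular). -/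
open Polynomial

/-- Rectangular property for `m` polynomials of degree `m - 1` given by their
root-sets: for some `1 < k ≤ m`, there exist at least `k` polynomials with at
least `m - k + 1` common roots. -/
def RP {n m : ℕ} (N : Fin m → Finset (Fin n)) : Prop :=
  ∃ k : ℕ, 1 < k ∧ k ≤ m ∧
    ∃ I : Finset (Fin m), k ≤ I.card ∧
      ∃ S : Finset (Fin n), m - k + 1 ≤ S.card ∧ ∀ i ∈ I, S ⊆ N i

/-- The root polynomial of a larger root-set factors through that of a smaller one. -/
theorem rootPoly_mul_sdiff (F : Type*) [Field F] {n : ℕ} {S Z : Finset (Fin n)} (h : S ⊆ Z) :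
    rootPoly F S * rootPoly F (Z \ S) = rootPoly F Z := by
  rw [mul_comm]
  exact Finset.prod_sdiff h

theorem rootPoly_degree (F : Type*) [Field F] {n : ℕ} (Z : Finset (Fin n)) :
    (rootPoly F Z).degree = Z.card := by
  simp [rootPoly, degree_prod]

theorem rootPoly_coeff_zero_ne_zero (F : Type*) [Field F] {n : ℕ} (Z : Finset (Fin n)) :
    (rootPoly F Z).coeff 0 ≠ 0 := by
  rw [coeff_zero_eq_eval_zero, rootPoly, eval_prod, Finset.prod_ne_zero_iff]
  intro γ _
  simp

/-- The endomorphism of `F[α_1, …, α_n]` setting the indeterminate `α_a` to zero. -/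
noncomputable def killVar (F : Type*) [Field F] {n : ℕ} (a : Fin n) :
    MvPolynomial (Fin n) F →ₐ[F] MvPolynomial (Fin n) F :=
  MvPolynomial.aeval fun j => if j = a then 0 else MvPolynomial.X j

theorem X_dvd_of_killVar_eq_zero {F : Type*} [Field F] {n : ℕ} {a : Fin n}
    {p : MvPolynomial (Fin n) F} (h : killVar F a p = 0) : MvPolynomial.X a ∣ p := by
  let I : Ideal (MvPolynomial (Fin n) F) := Ideal.span {MvPolynomial.X a}
  have key : (Ideal.Quotient.mkₐ F I).comp (killVar F a) = Ideal.Quotient.mkₐ F I := by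
    refine MvPolynomial.algHom_ext fun j => ?_
    by_cases hj : j = a
    · subst hj
      have : Ideal.Quotient.mk I (MvPolynomial.X j) = 0 :=
        Ideal.Quotient.eq_zero_iff_mem.2 (Ideal.subset_span rfl)
      simp [killVar, this]
    · simp [killVar, hj]
  have hp := DFunLike.congr_fun key p
  rw [AlgHom.comp_apply, h, map_zero] at hp
  exact Ideal.mem_span_singleton.1 (Ideal.Quotient.eq_zero_iff_mem.1 hp.symm)

theorem C_X_dvd_of_map_killVar_eq_zero {F : Type*} [Field F] {n : ℕ} {a : Fin n}
    {g : (MvPolynomial (Fin n) F)[X]} (h : g.map (killVar F a).toRingHom = 0) :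
    C (MvPolynomial.X a) ∣ g := by
  rw [C_dvd_iff_dvd_coeff]
  intro i
  apply X_dvd_of_killVar_eq_zero
  simpa using congrArg (fun q => q.coeff i) h

theorem rootPoly_map_killVar (F : Type*) [Field F] {n : ℕ} (a : Fin n) (Z : Finset (Fin n)) :
    (rootPoly F Z).map (killVar F a).toRingHom =
      rootPoly F (Z.erase a) * X ^ (if a ∈ Z then 1 else 0) := by
  have off : ∀ S : Finset (Fin n), a ∉ S →
      (rootPoly F S).map (killVar F a).toRingHom = rootPoly F S := by
    intro S hS
    rw [rootPoly, Polynomial.map_prod]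
    refine Finset.prod_congr rfl fun γ hγ => ?_
    have : γ ≠ a := fun h => hS (h ▸ hγ)
    simp [killVar, this]
  by_cases ha : a ∈ Z
  · have hZ : rootPoly F Z = rootPoly F (Z.erase a) * (X - C (MvPolynomial.X a)) :=
      (Finset.prod_erase_mul Z _ ha).symm
    rw [hZ, Polynomial.map_mul, off _ (Finset.notMem_erase a Z)]
    simp [killVar, ha]
  · rw [off Z ha, Finset.erase_eq_of_notMem ha]
    simp [ha]

/-- The only relation `∑ gᵢ · P(Zᵢ) · X ^ tᵢ = 0` with `deg gᵢ < dᵢ` is the trivial one. -/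
def OnlyTrivialRelation (F : Type*) [Field F] {n : ℕ} {ι : Type*} (s : Finset ι)
    (Z : ι → Finset (Fin n)) (t d : ι → ℕ) : Prop :=
  ∀ g : ι → (MvPolynomial (Fin n) F)[X], (∀ i ∈ s, (g i).degree < d i) →
    ∑ i ∈ s, g i * (rootPoly F (Z i) * X ^ t i) = 0 → ∀ i ∈ s, g i = 0

/-- The Hall-type condition bounding the common roots of every subfamily. -/
def HallCondition {n : ℕ} {ι : Type*} (k : ℕ) (s : Finset ι)
    (Z : ι → Finset (Fin n)) (t d : ι → ℕ) : Prop :=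
  ∀ Ω ⊆ s, Ω.Nonempty → ∀ (S : Finset (Fin n)) (τ : ℕ),
    (∀ i ∈ Ω, S ⊆ Z i ∧ τ ≤ t i) → S.card + τ + ∑ i ∈ Ω, d i ≤ k

section

variable {F : Type*} [Field F] {n : ℕ} {ι : Type*} {k : ℕ} {s : Finset ι}
  {Z : ι → Finset (Fin n)} {t d : ι → ℕ}

theorem HallCondition.mono (h : HallCondition k s Z t d) {s' : Finset ι} (hs : s' ⊆ s) :
    HallCondition k s' Z t d :=
  fun Ω hΩ => h Ω (hΩ.trans hs)

theorem HallCondition.pred (hH : HallCondition (k + 1) s Z t d) (ht : ∀ i ∈ s, t i ≠ 0) :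
    HallCondition k s Z (fun i => t i - 1) d := by
  intro Ω hΩ hne S τ hS
  have := hH Ω hΩ hne S (τ + 1) fun i hi => by
    have h1 := hS i hi
    have h2 := ht i (hΩ hi)
    exact ⟨h1.1, by simp only at h1; omega⟩
  omega

/-- Specializing one indeterminate to zero reflects the absence of nontrivial relations. -/
theorem OnlyTrivialRelation.of_erase (a : Fin n)
    (h : OnlyTrivialRelation F s (fun i => (Z i).erase a)
      (fun i => t i + if a ∈ Z i then 1 else 0) d) :
    OnlyTrivialRelation F s Z t d := by
  have ha0 : (C (MvPolynomial.X a) : (MvPolynomial (Fin n) F)[X]) ≠ 0 := by simp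
  have dvd : ∀ g : ι → (MvPolynomial (Fin n) F)[X], (∀ i ∈ s, (g i).degree < d i) →
      ∑ i ∈ s, g i * (rootPoly F (Z i) * X ^ t i) = 0 →
      ∀ i ∈ s, C (MvPolynomial.X a) ∣ g i := by
    intro g hg hsum i hi
    apply C_X_dvd_of_map_killVar_eq_zero
    refine h (fun i => (g i).map (killVar F a).toRingHom)
      (fun i hi => degree_map_le.trans_lt (hg i hi)) ?_ i hi
    have := congrArg (Polynomial.map (killVar F a).toRingHom) hsum
    rw [Polynomial.map_sum, Polynomial.map_zero] at this
    rw [← this]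
    refine Finset.sum_congr rfl fun i _ => ?_
    rw [Polynomial.map_mul, Polynomial.map_mul, rootPoly_map_killVar, Polynomial.map_pow, map_X]
    ring
  have pow_dvd : ∀ (N : ℕ) (g : ι → (MvPolynomial (Fin n) F)[X]),
      (∀ i ∈ s, (g i).degree < d i) → ∑ i ∈ s, g i * (rootPoly F (Z i) * X ^ t i) = 0 →
      ∀ i ∈ s, C (MvPolynomial.X a) ^ N ∣ g i := by
    intro N
    induction N with
    | zero => intros; simp
    | succ N ih =>
      intro g hg hsum i hi
      have : ∀ i, ∃ q, i ∈ s → g i = C (MvPolynomial.X a) * q := by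
        intro i
        by_cases hi : i ∈ s
        · obtain ⟨q, hq⟩ := dvd g hg hsum i hi
          exact ⟨q, fun _ => hq⟩
        · exact ⟨0, fun h => absurd h hi⟩
      choose q hq using this
      have hqd : ∀ i ∈ s, (q i).degree < d i := by
        intro i hi
        have := hg i hi
        rwa [hq i hi, degree_C_mul (MvPolynomial.X_ne_zero a)] at this
      have hqs : ∑ i ∈ s, q i * (rootPoly F (Z i) * X ^ t i) = 0 := by
        refine (mul_eq_zero.1 ?_).resolve_left ha0
        rw [Finset.mul_sum, ← hsum]
        refine Finset.sum_congr rfl fun i hi => ?_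
        rw [hq i hi, mul_assoc]
      rw [hq i hi, pow_succ']
      exact mul_dvd_mul_left _ (ih q hqd hqs i hi)
  intro g hg hsum i hi
  by_contra hne
  have hu : ¬ IsUnit (C (MvPolynomial.X a) : (MvPolynomial (Fin n) F)[X]) := by
    rw [isUnit_C]
    exact MvPolynomial.X_prime.not_isUnit
  obtain ⟨N, hN⟩ := FiniteMultiplicity.of_not_isUnit hu hne
  exact hN (pow_dvd (N + 1) g hg hsum i hi)

/-- When the common factor `X` divides every term, it can be cancelled. -/
theorem OnlyTrivialRelation.of_pred (ht : ∀ i ∈ s, t i ≠ 0)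
    (h : OnlyTrivialRelation F s Z (fun i => t i - 1) d) : OnlyTrivialRelation F s Z t d := by
  intro g hg hsum
  refine h g hg ((mul_eq_zero.1 ?_).resolve_left (X_ne_zero (R := MvPolynomial (Fin n) F)))
  rw [Finset.mul_sum, ← hsum]
  refine Finset.sum_congr rfl fun i hi => ?_
  obtain ⟨r, hr⟩ := Nat.exists_eq_succ_of_ne_zero (ht i hi)
  simp only [hr, Nat.succ_eq_add_one, Nat.add_sub_cancel, pow_succ]
  ring

variable [DecidableEq ι]

/-- A tight subfamily `Ω` can be replaced by its common part `P(S) · X ^ τ`. -/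
theorem OnlyTrivialRelation.of_merge {Ω : Finset ι} (hΩ : Ω ⊆ s) {i₀ : ι} (hi₀ : i₀ ∈ Ω)
    {S : Finset (Fin n)} {τ d₀ : ℕ} (hS : ∀ i ∈ Ω, S ⊆ Z i ∧ τ ≤ t i)
    (hd : ∀ i ∈ Ω, (Z i).card + t i + d i ≤ S.card + τ + d₀)
    (hin : OnlyTrivialRelation F Ω Z t d)
    (hout : OnlyTrivialRelation F (insert i₀ (s \ Ω)) (Function.update Z i₀ S)
      (Function.update t i₀ τ) (Function.update d i₀ d₀)) :
    OnlyTrivialRelation F s Z t d := by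
  intro g hg hsum
  let h := ∑ i ∈ Ω, g i * (rootPoly F (Z i \ S) * X ^ (t i - τ))
  have hh : h * (rootPoly F S * X ^ τ) = ∑ i ∈ Ω, g i * (rootPoly F (Z i) * X ^ t i) := by
    rw [Finset.sum_mul]
    refine Finset.sum_congr rfl fun i hi => ?_
    rw [← rootPoly_mul_sdiff F (hS i hi).1, ← Nat.sub_add_cancel (hS i hi).2,
      Nat.add_sub_cancel, pow_add]
    ring
  have hhd : h.degree < d₀ := by
    rw [← mem_degreeLT]
    refine Submodule.sum_mem _ fun i hi => mem_degreeLT.2 ?_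
    by_cases hz : g i = 0
    · simp [hz]
    have hgi := hg i (hΩ hi)
    rw [degree_mul, degree_mul, rootPoly_degree, degree_X_pow, degree_eq_natDegree hz]
    rw [degree_eq_natDegree hz] at hgi
    have hc := Finset.card_sdiff_add_card_eq_card (hS i hi).1
    have h1 := hd i hi
    have h2 := (hS i hi).2
    norm_cast at hgi ⊢
    omega
  have hne : ∀ i ∈ s \ Ω, i ≠ i₀ := fun i hi e => (Finset.mem_sdiff.1 hi).2 (e ▸ hi₀)
  have hnot : i₀ ∉ s \ Ω := fun hi => hne i₀ hi rfl
  have hzero := hout (Function.update g i₀ h) (by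
    intro i hi
    rcases Finset.mem_insert.1 hi with rfl | hi
    · simpa using hhd
    · simpa [hne i hi] using hg i (Finset.mem_sdiff.1 hi).1) (by
    rw [Finset.sum_insert hnot, ← hsum, ← Finset.sum_sdiff hΩ, ← hh, add_comm]
    congr 1
    · refine Finset.sum_congr rfl fun i hi => ?_
      simp [hne i hi]
    · simp)
  have hh0 : h = 0 := by simpa using hzero i₀ (Finset.mem_insert_self _ _)
  intro i hi
  by_cases hiΩ : i ∈ Ω
  · exact hin g (fun i hi => hg i (hΩ hi)) (by rw [← hh, hh0, zero_mul]) i hiΩ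
  · have hm : i ∈ s \ Ω := Finset.mem_sdiff.2 ⟨hi, hiΩ⟩
    simpa [hne i hm] using hzero i (Finset.mem_insert_of_mem hm)

theorem HallCondition.merge (hH : HallCondition k s Z t d) {Ω : Finset ι} (hΩ : Ω ⊆ s)
    {i₀ : ι} (hi₀ : i₀ ∈ Ω) {S : Finset (Fin n)} {τ : ℕ} (hS : ∀ i ∈ Ω, S ⊆ Z i ∧ τ ≤ t i) :
    HallCondition k (insert i₀ (s \ Ω)) (Function.update Z i₀ S)
      (Function.update t i₀ τ) (Function.update d i₀ (∑ i ∈ Ω, d i)) := by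
  intro Ω' hΩ' hne S' τ' hS'
  have hmem : ∀ i ∈ Ω', i ≠ i₀ → i ∈ s \ Ω := fun i hi hn =>
    (Finset.mem_insert.1 (hΩ' hi)).resolve_left hn
  by_cases hi : i₀ ∈ Ω'
  · have h0 := hS' i₀ hi
    simp only [Function.update_self] at h0
    have hdisj : Disjoint (Ω'.erase i₀) Ω := by
      rw [Finset.disjoint_left]
      intro i hi'
      obtain ⟨hn, hi'⟩ := Finset.mem_erase.1 hi'
      exact (Finset.mem_sdiff.1 (hmem i hi' hn)).2
    have key := hH (Ω'.erase i₀ ∪ Ω) (Finset.union_subset (fun i hi' => by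
      obtain ⟨hn, hi'⟩ := Finset.mem_erase.1 hi'
      exact (Finset.mem_sdiff.1 (hmem i hi' hn)).1) hΩ)
      ⟨i₀, Finset.mem_union_right _ hi₀⟩ S' τ' (by
      intro i hi'
      rcases Finset.mem_union.1 hi' with hi' | hi'
      · obtain ⟨hn, hi'⟩ := Finset.mem_erase.1 hi'
        simpa [hn] using hS' i hi'
      · exact ⟨h0.1.trans (hS i hi').1, h0.2.trans (hS i hi').2⟩)
    rw [Finset.sum_union hdisj] at key
    rw [← Finset.sum_erase_add _ _ hi, Function.update_self]
    rw [Finset.sum_congr rfl fun i hi' =>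
      Function.update_of_ne (Finset.ne_of_mem_erase hi') _ d]
    exact key
  · have hn : ∀ i ∈ Ω', i ≠ i₀ := fun i hi' e => hi (e ▸ hi')
    rw [Finset.sum_congr rfl fun i hi' => Function.update_of_ne (hn i hi') _ d]
    refine hH Ω' (fun i hi' => (Finset.mem_sdiff.1 (hmem i hi' (hn i hi'))).1) hne S' τ'
      fun i hi' => ?_
    have hSi := hS' i hi'
    simpa [hn i hi'] using hSi

/-- When all but one of the terms are divisible by `X`, so is the coefficient of that term. -/
theorem OnlyTrivialRelation.of_pred_of_unique {i₀ : ι} (hi₀ : i₀ ∈ s) (h0 : t i₀ = 0)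
    (ht : ∀ i ∈ s, i ≠ i₀ → t i ≠ 0) (hd0 : d i₀ ≠ 0)
    (h : OnlyTrivialRelation F s Z (fun i => t i - 1) (Function.update d i₀ (d i₀ - 1))) :
    OnlyTrivialRelation F s Z t d := by
  intro g hg hsum
  have hX : X ∣ g i₀ := by
    rw [X_dvd_iff]
    have hc := congrArg (fun q => q.coeff 0) hsum
    simp only [finsetSum_coeff, coeff_zero] at hc
    rw [Finset.sum_eq_single_of_mem i₀ hi₀] at hc
    · rw [h0, pow_zero, mul_one, mul_coeff_zero] at hc
      exact (mul_eq_zero.1 hc).resolve_right (rootPoly_coeff_zero_ne_zero F _)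
    · intro i hi hn
      simp [mul_coeff_zero, (ht i hi hn).symm]
  obtain ⟨q, hq⟩ := hX
  have hzero := h (Function.update g i₀ q) (by
    intro i hi
    by_cases hn : i = i₀
    · subst hn
      have hgi := hg i hi
      by_cases hz : q = 0
      · simp [hz]
      rw [hq, degree_mul, degree_X, degree_eq_natDegree hz] at hgi
      simp only [Function.update_self]
      rw [degree_eq_natDegree hz]
      norm_cast at hgi ⊢
      omega
    · simpa [hn] using hg i hi) (by
    refine (mul_eq_zero.1 ?_).resolve_left (X_ne_zero (R := MvPolynomial (Fin n) F))
    rw [Finset.mul_sum, ← hsum]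
    refine Finset.sum_congr rfl fun i hi => ?_
    by_cases hn : i = i₀
    · subst hn
      simp [h0, hq, mul_assoc]
    · obtain ⟨r, hr⟩ := Nat.exists_eq_succ_of_ne_zero (ht i hi hn)
      simp only [Function.update_of_ne hn, hr, Nat.succ_eq_add_one, Nat.add_sub_cancel, pow_succ]
      ring)
  intro i hi
  by_cases hn : i = i₀
  · subst hn
    have : q = 0 := by simpa using hzero i hi
    rw [hq, this, mul_zero]
  · simpa [hn] using hzero i hi

/-- A zero-dimensional term can be dropped. -/
theorem OnlyTrivialRelation.of_erase_index {i₀ : ι} (hi₀ : i₀ ∈ s) (hd0 : d i₀ = 0)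
    (h : OnlyTrivialRelation F (s.erase i₀) Z t d) : OnlyTrivialRelation F s Z t d := by
  intro g hg hsum
  have hz : g i₀ = 0 := by
    have := hg i₀ hi₀
    rw [hd0] at this
    simpa using this
  have := h g (fun i hi => hg i (Finset.mem_of_mem_erase hi)) (by
    rw [← hsum, ← Finset.sum_erase_add _ _ hi₀, hz, zero_mul, add_zero])
  intro i hi
  by_cases hn : i = i₀
  · rw [hn, hz]
  · exact this i (Finset.mem_erase.2 ⟨hn, hi⟩)

theorem HallCondition.pred_of_unique (hH : HallCondition (k + 1) s Z t d) {i₀ : ι}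
    (h0 : t i₀ = 0) (ht : ∀ i ∈ s, i ≠ i₀ → t i ≠ 0) (hd0 : d i₀ ≠ 0) :
    HallCondition k s Z (fun i => t i - 1) (Function.update d i₀ (d i₀ - 1)) := by
  intro Ω hΩ hne S τ hS
  by_cases hi : i₀ ∈ Ω
  · have hτ : τ ≤ t i₀ - 1 := (hS i₀ hi).2
    have hsum : ∑ i ∈ Ω.erase i₀, Function.update d i₀ (d i₀ - 1) i = ∑ i ∈ Ω.erase i₀, d i :=
      Finset.sum_congr rfl fun i hi' => Function.update_of_ne (Finset.ne_of_mem_erase hi') _ d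
    have := hH Ω hΩ hne S 0 fun i hi => ⟨(hS i hi).1, Nat.zero_le _⟩
    rw [← Finset.sum_erase_add _ _ hi] at this ⊢
    rw [Function.update_self, hsum]
    omega
  · have hn : ∀ i ∈ Ω, i ≠ i₀ := fun i hi' e => hi (e ▸ hi')
    rw [Finset.sum_congr rfl fun i hi' => Function.update_of_ne (hn i hi') _ d]
    exact (hH.mono hΩ).pred (fun i hi' => ht i (hΩ hi') (hn i hi')) Ω subset_rfl hne S τ hS

theorem card_erase_add_ite (a : Fin n) (A : Finset (Fin n)) :
    (A.erase a).card + (if a ∈ A then 1 else 0) = A.card := by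
  split_ifs with h
  · exact Finset.card_erase_add_one h
  · rw [Finset.erase_eq_of_notMem h, add_zero]

/-- If no proper subfamily with at least two members is tight, then the Hall condition survives
setting to zero an indeterminate missing from some `Z i₀` with `t i₀ = 0`. -/
theorem HallCondition.erase (hH : HallCondition k s Z t d)
    (hk : ∀ i ∈ s, (Z i).card + t i + d i = k)
    (hstrict : ∀ Ω ⊆ s, 1 < Ω.card → Ω ≠ s → ∀ (S : Finset (Fin n)) (τ : ℕ),
      (∀ i ∈ Ω, S ⊆ Z i ∧ τ ≤ t i) → S.card + τ + ∑ i ∈ Ω, d i ≠ k)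
    {i₀ : ι} (hi₀ : i₀ ∈ s) (h0 : t i₀ = 0) {a : Fin n} (ha : a ∉ Z i₀) :
    HallCondition k s (fun i => (Z i).erase a) (fun i => t i + if a ∈ Z i then 1 else 0) d := by
  intro Ω hΩ hne S τ hS
  have hSZ : ∀ i ∈ Ω, S ⊆ Z i := fun i hi => (hS i hi).1.trans (Finset.erase_subset _ _)
  by_cases hone : Ω.card = 1
  · obtain ⟨i, rfl⟩ := Finset.card_eq_one.1 hone
    have h1 := hS i (Finset.mem_singleton_self i)
    have h2 := Finset.card_le_card h1.1
    have h3 := card_erase_add_ite a (Z i)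
    have h4 := hk i (hΩ (Finset.mem_singleton_self i))
    have h5 := h1.2
    rw [Finset.sum_singleton]
    simp only at h2 h5
    omega
  by_cases hall : Ω = s
  · subst hall
    have h1 := (hS i₀ hi₀).2
    simp only [h0, ha, if_false] at h1
    exact hH Ω hΩ hne S τ fun i hi => ⟨hSZ i hi, by omega⟩
  · have hpos := hne.card_pos
    have hS1 : ∀ i ∈ Ω, S ⊆ Z i ∧ τ - 1 ≤ t i := fun i hi => by
      refine ⟨hSZ i hi, ?_⟩
      have h1 := (hS i hi).2
      simp only at h1
      split_ifs at h1 <;> omega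
    have h2 := hH Ω hΩ hne S (τ - 1) hS1
    have h3 := hstrict Ω hΩ (by omega) hall S (τ - 1) hS1
    omega

/-- The GM-MDS theorem: the Hall condition excludes nontrivial relations. -/
theorem OnlyTrivialRelation.of_hallCondition (hH : HallCondition k s Z t d)
    (hk : ∀ i ∈ s, (Z i).card + t i + d i = k) : OnlyTrivialRelation F s Z t d := by
  induction hM : k + s.card + ∑ i ∈ s, (Z i).card using Nat.strong_induction_on
    generalizing k s Z t d with
  | _ M ih =>
  by_cases hd : ∃ i₀ ∈ s, d i₀ = 0
  · obtain ⟨i₀, hi₀, hd0⟩ := hd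
    refine .of_erase_index hi₀ hd0 (ih _ ?_ (hH.mono (Finset.erase_subset _ _))
      (fun i hi => hk i (Finset.mem_of_mem_erase hi)) rfl)
    have h1 := Finset.card_erase_lt_of_mem hi₀
    have h2 := Finset.sum_erase_add s (fun i => (Z i).card) hi₀
    omega
  push Not at hd
  by_cases htight : ∃ Ω ⊆ s, 1 < Ω.card ∧ Ω ≠ s ∧ ∃ (S : Finset (Fin n)) (τ : ℕ),
      (∀ i ∈ Ω, S ⊆ Z i ∧ τ ≤ t i) ∧ S.card + τ + ∑ i ∈ Ω, d i = k
  · obtain ⟨Ω, hΩ, hcard, hne, S, τ, hS, heq⟩ := htight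
    obtain ⟨i₀, hi₀⟩ := Finset.card_pos.1 (by omega : 0 < Ω.card)
    have hn : ∀ i ∈ s \ Ω, i ≠ i₀ := fun i hi e => (Finset.mem_sdiff.1 hi).2 (e ▸ hi₀)
    have hnot : i₀ ∉ s \ Ω := fun hi => hn i₀ hi rfl
    have hc := Finset.card_sdiff_add_card_eq_card hΩ
    have hsum := Finset.sum_sdiff (f := fun i => (Z i).card) hΩ
    refine .of_merge hΩ hi₀ hS (d₀ := ∑ i ∈ Ω, d i)
      (fun i hi => ((hk i (hΩ hi)).trans heq.symm).le)
      (ih _ ?_ (hH.mono hΩ) (fun i hi => hk i (hΩ hi)) rfl)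
      (ih _ ?_ (hH.merge hΩ hi₀ hS) ?_ rfl)
    · have := Finset.card_lt_card (Finset.ssubset_iff_subset_ne.2 ⟨hΩ, hne⟩)
      omega
    · rw [Finset.card_insert_of_notMem hnot, Finset.sum_insert hnot, Function.update_self,
        Finset.sum_congr rfl fun i hi => by rw [Function.update_of_ne (hn i hi)]]
      have h1 := Finset.card_le_card (hS i₀ hi₀).1
      have h2 := Finset.single_le_sum (f := fun i => (Z i).card)
        (fun _ _ => Nat.zero_le _) hi₀
      omega
    · intro i hi
      rcases Finset.mem_insert.1 hi with rfl | hi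
      · simpa using heq
      · simpa [hn i hi] using hk i (Finset.mem_sdiff.1 hi).1
  push Not at htight
  by_cases hall : ∀ i ∈ s, t i ≠ 0
  · rcases s.eq_empty_or_nonempty with rfl | ⟨j, hj⟩
    · intro g _ _ i hi
      simp at hi
    obtain ⟨k, rfl⟩ := Nat.exists_eq_succ_of_ne_zero (n := k) (by
      have := hk j hj
      have := hd j hj
      omega)
    refine .of_pred hall (ih _ ?_ (hH.pred hall) ?_ rfl)
    · omega
    · intro i hi
      have := hk i hi
      have := hall i hi
      omega
  push Not at hall
  obtain ⟨i₀, hi₀, h0⟩ := hall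
  by_cases huniq : ∀ i ∈ s, i ≠ i₀ → t i ≠ 0
  · obtain ⟨k, rfl⟩ := Nat.exists_eq_succ_of_ne_zero (n := k) (by
      have := hk i₀ hi₀
      have := hd i₀ hi₀
      omega)
    refine .of_pred_of_unique hi₀ h0 huniq (hd i₀ hi₀)
      (ih _ ?_ (hH.pred_of_unique h0 huniq (hd i₀ hi₀)) ?_ rfl)
    · omega
    · intro i hi
      have h1 := hk i hi
      have h2 := hd i hi
      by_cases hn : i = i₀
      · subst hn
        simp only [Function.update_self]
        omega
      · have := huniq i hi hn
        simp only [Function.update_of_ne hn]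
        omega
  push Not at huniq
  obtain ⟨j, hj, hji, hj0⟩ := huniq
  obtain ⟨a, haj, hai⟩ : ∃ a ∈ Z j, a ∉ Z i₀ := by
    by_contra! hsub
    have h1 := hH {i₀, j} (by
      intro i hi
      rcases Finset.mem_insert.1 hi with rfl | hi
      · exact hi₀
      · rwa [Finset.mem_singleton.1 hi]) ⟨i₀, by simp⟩ (Z j) 0 (by
      intro i hi
      refine ⟨?_, Nat.zero_le _⟩
      rcases Finset.mem_insert.1 hi with rfl | hi
      · exact hsub
      · rw [Finset.mem_singleton.1 hi])
    rw [Finset.sum_pair hji.symm] at h1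
    have h2 := hk j hj
    have h3 := hd i₀ hi₀
    omega
  refine .of_erase a (ih _ ?_ (hH.erase hk htight hi₀ h0 hai) ?_ rfl)
  · have : ∑ i ∈ s, ((Z i).erase a).card < ∑ i ∈ s, (Z i).card :=
      Finset.sum_lt_sum (fun i _ => Finset.card_le_card (Finset.erase_subset _ _))
        ⟨j, hj, Finset.card_erase_lt_of_mem haj⟩
    omega
  · intro i hi
    have h1 := hk i hi
    have h2 := card_erase_add_ite a (Z i)
    omega

end

theorem hallCondition_of_not_RP {n m : ℕ} {N : Fin m → Finset (Fin n)}
    (hdeg : ∀ i, (N i).card = m - 1) (hNRP : ¬ RP N) :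
    HallCondition m Finset.univ N (fun _ => 0) (fun _ => 1) := by
  intro Ω _ hne S τ hS
  have hpos := hne.card_pos
  have hle : Ω.card ≤ m := by simpa using Finset.card_le_univ Ω
  obtain ⟨i, hi⟩ := hne
  have hτ : τ = 0 := Nat.le_zero.1 (hS i hi).2
  rw [hτ, Finset.sum_const, smul_eq_mul, mul_one, add_zero]
  by_cases hone : Ω.card = 1
  · have h1 := Finset.card_le_card (hS i hi).1
    rw [hdeg i] at h1
    omega
  · by_contra hlt
    exact hNRP ⟨Ω.card, by omega, hle, Ω, le_rfl, S, by omega, fun i hi => (hS i hi).1⟩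

/-- For `2 ≤ m ≤ 5` and `m` polynomials of degree exactly `m - 1`: if
`{P_1, …, P_m}` has NRP, then `W(P_1, …, P_m)` is not the zero polynomial,
i.e. the transformation matrix `T` is not generically singular. -/
theorem Wdet_ne_zero_of_nrp (F : Type*) [Field F] {n m : ℕ}
    (hm2 : 2 ≤ m) (hm5 : m ≤ 5)
    (N : Fin m → Finset (Fin n))
    (hdeg : ∀ i, (N i).card = m - 1)
    (hNRP : ¬ RP N) :
    Wdet F N ≠ 0 := by
  classical
  intro hW
  obtain ⟨v, hv, hMv⟩ := Matrix.exists_mulVec_eq_zero_iff.2 hW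
  have htriv : OnlyTrivialRelation F Finset.univ N (fun _ => 0) (fun _ => 1) :=
    .of_hallCondition (hallCondition_of_not_RP hdeg hNRP) fun i _ => by
      have := hdeg i
      omega
  refine hv (funext fun i => ?_)
  refine C_eq_zero.1 (htriv (fun j => C (v j)) (fun j _ => ?_) ?_ i (Finset.mem_univ i))
  · exact degree_C_le.trans_lt (by norm_num)
  · ext1 r
    simp only [pow_zero, mul_one, finsetSum_coeff, coeff_C_mul, coeff_zero]
    by_cases hr : r < m
    · have := congrFun hMv ⟨r, hr⟩
      simp only [Matrix.mulVec, dotProduct, Matrix.of_apply, Pi.zero_apply] at this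
      rw [← this]
      exact Finset.sum_congr rfl fun j _ => mul_comm _ _
    · refine Finset.sum_eq_zero fun j _ => ?_
      rw [coeff_eq_zero_of_degree_lt, mul_zero]
      rw [rootPoly_degree, hdeg j]
      norm_cast
      omega
end
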